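/- Assume the Kakeya maximal function conjecture: $\|M_\delta f\|_{L^n(S^{n-1})} \leq C(\epsilon)\delta^{-\epsilon}\|f\|_{L^n(\mathbb{R}^n)}$ for all $\epsilon > 0$. Then every Kakeya set $K \subset \mathbb{R}^n$ has conformal dimension $n$; that is, $\dim_{\mathrm{H}} g(K) \geq n$ for every quasisymmetric homeomorphism $g$ of $K$ onto any metric space. -/

import Mathlib

open Set Metric MeasureTheory ENNReal

noncomputable section

/-- The unit line segment from `x` in direction `e`. -/
def seg {n : ℕ} (e x : EuclideanSpace ℝ (Fin n)) : Set (EuclideanSpace ℝ (Fin n)) :=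
  (fun t : ℝ => x + t • e) '' Set.Icc (0:ℝ) 1

/-- The closed `δ`-tube around the unit segment from `x` in direction `e`. -/
def tube {n : ℕ} (δ : ℝ) (e x : EuclideanSpace ℝ (Fin n)) : Set (EuclideanSpace ℝ (Fin n)) :=
  Metric.cthickening δ (seg e x)

/-- The Kakeya maximal function. -/
def kakeyaMax {n : ℕ} (δ : ℝ) (f : EuclideanSpace ℝ (Fin n) → ℝ)
    (e : EuclideanSpace ℝ (Fin n)) : ℝ≥0∞ :=
  ⨆ x : EuclideanSpace ℝ (Fin n),
    (∫⁻ y in tube δ e x, ENNReal.ofReal |f y|) / volume (tube δ e x)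

/-- `η` is a quasisymmetry gauge: an increasing homeomorphism of `[0,∞)` onto itself. -/
def IsQSGauge (η : ℝ → ℝ) : Prop :=
  η 0 = 0 ∧ StrictMonoOn η (Set.Ici 0) ∧ ContinuousOn η (Set.Ici 0) ∧
    Set.MapsTo η (Set.Ici 0) (Set.Ici 0) ∧ Set.SurjOn η (Set.Ici 0) (Set.Ici 0)

/-- `g` is `η`-quasisymmetric on `K`. -/
def IsQSOn {X Y : Type*} [MetricSpace X] [MetricSpace Y] (η : ℝ → ℝ) (g : X → Y)
    (K : Set X) : Prop :=
  ∀ x ∈ K, ∀ y ∈ K, ∀ z ∈ K, x ≠ z →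
    dist (g x) (g y) ≤ η (dist x y / dist x z) * dist (g x) (g z)

/-- The multi-index of the cell of the grid of mesh `s` containing `y`. -/
def gridIdx {n : ℕ} (s : ℝ) (y : EuclideanSpace ℝ (Fin n)) : Fin n → ℤ :=
  fun j => ⌊y j / s⌋

/-- The corner of the grid cell with multi-index `Q`. -/
def gridPt {n : ℕ} (s : ℝ) (Q : Fin n → ℤ) : EuclideanSpace ℝ (Fin n) :=
  WithLp.toLp 2 (fun j => s * Q j)

/-- The vectors `e` for which the segment from `x` to `x + e` comes within `r` of `c`. -/
def nearDirs {n : ℕ} (r : ℝ) (c x : EuclideanSpace ℝ (Fin n)) :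
    Set (EuclideanSpace ℝ (Fin n)) :=
  {e | ∃ t ∈ Set.Icc (0:ℝ) 1, dist c (x + t • e) < r}

/-- A discrete, lower semicontinuous variant of the Kakeya maximal function: the largest total
weight of the cells whose corners lie within `r` of a segment in direction `e`. -/
def gridMax {n : ℕ} (s r : ℝ) (w : (Fin n → ℤ) → ℝ≥0∞) (e : EuclideanSpace ℝ (Fin n)) :
    ℝ≥0∞ :=
  ⨆ x, ∑' Q, (nearDirs r (gridPt s Q) x).indicator (fun _ => w Q) e

lemma dist_gridPt_gridIdx_le {n : ℕ} {s : ℝ} (hs : 0 < s) (y : EuclideanSpace ℝ (Fin n)) :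
    dist y (gridPt s (gridIdx s y)) ≤ n * s := by
  have h : ∀ j, dist (y j) (gridPt s (gridIdx s y) j) ≤ s := by
    intro j
    have e : y j - s * (⌊y j / s⌋ : ℝ) = s * Int.fract (y j / s) := by
      rw [Int.fract]; field_simp
    simp only [gridPt, gridIdx, Real.dist_eq, e]
    rw [abs_of_nonneg (mul_nonneg hs.le (Int.fract_nonneg _))]
    nlinarith [Int.fract_lt_one (y j / s)]
  rw [EuclideanSpace.dist_eq]
  refine Real.sqrt_le_iff.2 ⟨by positivity, ?_⟩
  calc ∑ j, dist (y j) (gridPt s (gridIdx s y) j) ^ 2 ≤ ∑ _j : Fin n, s ^ 2 :=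
        Finset.sum_le_sum fun j _ => pow_le_pow_left₀ dist_nonneg (h j) 2
    _ = n * s ^ 2 := by simp
    _ ≤ (n * s) ^ 2 := by
        rw [mul_pow]
        refine mul_le_mul_of_nonneg_right ?_ (sq_nonneg s)
        exact_mod_cast Nat.le_self_pow two_ne_zero n

lemma measurable_gridIdx {n : ℕ} (s : ℝ) :
    Measurable (gridIdx s : EuclideanSpace ℝ (Fin n) → Fin n → ℤ) := by
  refine measurable_pi_lambda _ fun j => ?_
  refine Int.measurable_floor.comp ?_
  fun_prop

lemma volume_gridIdx_preimage {n : ℕ} {s : ℝ} (hs : 0 < s) (Q : Fin n → ℤ) :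
    volume ((gridIdx s : EuclideanSpace ℝ (Fin n) → Fin n → ℤ) ⁻¹' {Q}) =
      ENNReal.ofReal s ^ n := by
  have h : (gridIdx s : EuclideanSpace ℝ (Fin n) → Fin n → ℤ) ⁻¹' {Q} =
      (WithLp.ofLp : EuclideanSpace ℝ (Fin n) → Fin n → ℝ) ⁻¹'
        (Set.univ.pi fun j => Set.Ico (s * Q j) (s * Q j + s)) := by
    ext y
    simp only [gridIdx, mem_preimage, mem_singleton_iff, funext_iff, Set.mem_univ_pi, mem_Ico,
      Int.floor_eq_iff]
    refine forall_congr' fun j => ?_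
    rw [le_div_iff₀ hs, div_lt_iff₀ hs, mul_comm s, add_mul, one_mul]
  rw [h, (PiLp.volume_preserving_ofLp (Fin n)).measure_preimage
    (MeasurableSet.univ_pi fun _ => measurableSet_Ico).nullMeasurableSet, Real.volume_pi_Ico]
  simp

lemma lintegral_comp_gridIdx {n : ℕ} (s : ℝ) (μ : Measure (EuclideanSpace ℝ (Fin n)))
    (φ : (Fin n → ℤ) → ℝ≥0∞) :
    ∫⁻ y, φ (gridIdx s y) ∂μ = ∑' Q, φ Q * μ (gridIdx s ⁻¹' {Q}) := by
  rw [← lintegral_map (f := φ) (measurable_of_countable φ) (measurable_gridIdx s), lintegral_countable']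
  refine tsum_congr fun Q => ?_
  rw [Measure.map_apply (measurable_gridIdx s) (measurableSet_singleton Q)]

lemma isOpen_nearDirs {n : ℕ} (r : ℝ) (c x : EuclideanSpace ℝ (Fin n)) :
    IsOpen (nearDirs r c x) := by
  have h : nearDirs r c x = ⋃ t ∈ Set.Icc (0:ℝ) 1, {e | dist c (x + t • e) < r} := by
    ext e; simp [nearDirs]
  rw [h]
  exact isOpen_biUnion fun t _ => isOpen_lt (by fun_prop) continuous_const

lemma measurable_gridMax {n : ℕ} (s r : ℝ) (w : (Fin n → ℤ) → ℝ≥0∞) :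
    Measurable (gridMax s r w) := by
  refine LowerSemicontinuous.measurable ?_
  refine lowerSemicontinuous_iSup fun x => lowerSemicontinuous_tsum fun Q => ?_
  exact (isOpen_nearDirs _ _ _).lowerSemicontinuous_indicator zero_le

lemma exists_volume_tube_le (n : ℕ) :
    ∃ V > (0:ℝ), ∀ δ ∈ Set.Ioo (0:ℝ) 1, ∀ e x : EuclideanSpace ℝ (Fin n), ‖e‖ ≤ 1 →
      volume (tube δ e x) ≤ ENNReal.ofReal (V * δ ^ n * δ⁻¹) := by
  set b := volume (ball (0 : EuclideanSpace ℝ (Fin n)) 1) with hb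
  have hbfin : b ≠ ⊤ := measure_ball_lt_top.ne
  have hbpos : 0 < b.toReal := ENNReal.toReal_pos (measure_ball_pos _ _ one_pos).ne' hbfin
  refine ⟨2 * 2 ^ n * b.toReal, by positivity, ?_⟩
  rintro δ ⟨h0, h1⟩ e x he
  have hcomp : IsCompact (seg e x) := isCompact_Icc.image (by fun_prop)
  have hsub : tube δ e x ⊆
      ⋃ i ∈ Finset.range (⌊1 / δ⌋₊ + 1), closedBall (x + ((i : ℝ) * δ) • e) (2 * δ) := by
    intro y hy
    rw [tube, hcomp.cthickening_eq_biUnion_closedBall h0.le] at hy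
    obtain ⟨z, ⟨t, ht, rfl⟩, hyz⟩ := mem_iUnion₂.1 hy
    refine mem_iUnion₂.2 ⟨⌊t / δ⌋₊, ?_, ?_⟩
    · rw [Finset.mem_range, Nat.lt_succ_iff]
      exact Nat.floor_le_floor (by gcongr; exact ht.2)
    · have hfl := Nat.floor_le (div_nonneg ht.1 h0.le)
      have hfl2 := (Nat.lt_floor_add_one (t / δ)).le
      rw [le_div_iff₀ h0] at hfl
      rw [div_le_iff₀ h0, add_mul, one_mul] at hfl2
      have h2 : dist (x + t • e) (x + ((⌊t / δ⌋₊ : ℝ) * δ) • e) ≤ δ := by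
        rw [dist_add_left, dist_eq_norm, ← sub_smul, norm_smul, Real.norm_eq_abs,
          abs_of_nonneg (by linarith)]
        nlinarith [norm_nonneg e]
      rw [mem_closedBall] at hyz ⊢
      linarith [dist_triangle y (x + t • e) (x + ((⌊t / δ⌋₊ : ℝ) * δ) • e)]
  have hcount : ((⌊1 / δ⌋₊ + 1 : ℕ) : ℝ) ≤ 2 * δ⁻¹ := by
    push_cast
    have := Nat.floor_le (one_div_pos.2 h0).le
    have h3 : 1 ≤ δ⁻¹ := (one_le_inv₀ h0).2 h1.le
    rw [one_div] at *
    linarith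
  calc volume (tube δ e x)
      ≤ ∑ i ∈ Finset.range (⌊1 / δ⌋₊ + 1),
          volume (closedBall (x + ((i : ℝ) * δ) • e) (2 * δ)) :=
        (measure_mono hsub).trans (measure_biUnion_finset_le _ _)
    _ = ENNReal.ofReal ((⌊1 / δ⌋₊ + 1 : ℕ) * ((2 * δ) ^ n * b.toReal)) := by
        have : ∀ z : EuclideanSpace ℝ (Fin n), volume (closedBall z (2 * δ)) =
            ENNReal.ofReal ((2 * δ) ^ n * b.toReal) := by
          intro z
          rw [Measure.addHaar_closedBall _ _ (by positivity), finrank_euclideanSpace_fin,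
            ENNReal.ofReal_mul (by positivity), ENNReal.ofReal_toReal hbfin]
        simp only [this, Finset.sum_const, Finset.card_range, nsmul_eq_mul]
        rw [ENNReal.ofReal_mul (Nat.cast_nonneg _), ENNReal.ofReal_natCast]
    _ ≤ _ := by
        refine ENNReal.ofReal_le_ofReal ?_
        calc _ ≤ 2 * δ⁻¹ * ((2 * δ) ^ n * b.toReal) := by gcongr
          _ = _ := by rw [mul_pow]; ring

lemma mul_gridMax_le_kakeyaMax {n : ℕ} {B V : ℝ} (hB : 0 < B) (hV : 0 < V)
    (hvol : ∀ δ ∈ Set.Ioo (0:ℝ) 1, ∀ e x : EuclideanSpace ℝ (Fin n), ‖e‖ ≤ 1 →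
      volume (tube δ e x) ≤ ENNReal.ofReal (V * δ ^ n * δ⁻¹))
    {s r : ℝ} (hs : 0 < s) (hBs : B * s < 1) (hr : r + n * s ≤ B * s)
    (w : (Fin n → ℤ) → ℝ≥0∞) (hw : ∀ Q, w Q ≠ ⊤)
    {e : EuclideanSpace ℝ (Fin n)} (he : ‖e‖ ≤ 1) :
    ENNReal.ofReal (B / (V * B ^ n) * s) * gridMax s r w e ≤
      kakeyaMax (B * s) (fun y => (w (gridIdx s y)).toReal) e := by
  rw [gridMax, ENNReal.mul_iSup]
  refine iSup_le fun x => le_trans ?_ (le_iSup _ x)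
  have hδ : 0 < B * s := by positivity
  have hpos : 0 < V * (B * s) ^ n * (B * s)⁻¹ := by positivity
  refine le_trans ?_ (ENNReal.div_le_div_left (hvol (B * s) ⟨hδ, hBs⟩ e x he) _)
  have hint : ENNReal.ofReal (s ^ n) *
      ∑' Q, (nearDirs r (gridPt s Q) x).indicator (fun _ => w Q) e ≤
      ∫⁻ y in tube (B * s) e x, ENNReal.ofReal |(w (gridIdx s y)).toReal| := by
    have : ∀ y : EuclideanSpace ℝ (Fin n),
        ENNReal.ofReal |(w (gridIdx s y)).toReal| = w (gridIdx s y) := fun y => by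
      rw [abs_of_nonneg ENNReal.toReal_nonneg, ENNReal.ofReal_toReal (hw _)]
    simp only [this]
    rw [lintegral_comp_gridIdx, ← ENNReal.tsum_mul_left]
    refine ENNReal.tsum_le_tsum fun Q => ?_
    by_cases hQ : e ∈ nearDirs r (gridPt s Q) x
    · rw [indicator_of_mem hQ, mul_comm]
      refine mul_le_mul_right ?_ _
      obtain ⟨t, ht, htr⟩ := hQ
      have hsub : gridIdx s ⁻¹' {Q} ⊆ tube (B * s) e x := by
        intro y hy
        rw [mem_preimage, mem_singleton_iff] at hy
        have h1 := dist_gridPt_gridIdx_le hs y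
        rw [hy] at h1
        refine mem_cthickening_of_dist_le y (x + t • e) _ _ ⟨t, ht, rfl⟩ ?_
        linarith [dist_triangle y (gridPt s Q) (x + t • e)]
      rw [Measure.restrict_eq_self _ hsub, volume_gridIdx_preimage hs, ENNReal.ofReal_pow hs.le]
    · rw [indicator_of_notMem hQ]; simp
  rw [ENNReal.le_div_iff_mul_le (Or.inl (ENNReal.ofReal_pos.2 hpos).ne')
    (Or.inl ENNReal.ofReal_ne_top)]
  refine le_trans (le_of_eq ?_) hint
  rw [mul_right_comm, ← ENNReal.ofReal_mul (by positivity)]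
  congr 2
  field_simp
  rw [mul_pow]

/-- A weak-type bound for `gridMax` deduced from a strong-type bound for the Kakeya maximal
function. -/
lemma exists_measure_gridMax_ge_le {n : ℕ} (hn : 0 < n) {ε C : ℝ} (hC : 0 < C)
    (hyp : ∀ δ ∈ Set.Ioo (0:ℝ) 1,
      ∀ f : EuclideanSpace ℝ (Fin n) → ℝ, Measurable f →
        (∫⁻ e in Metric.sphere (0 : EuclideanSpace ℝ (Fin n)) 1,
            (kakeyaMax δ f e) ^ (n : ℝ) ∂(μH[((n : ℝ) - 1)])) ^ (1 / (n : ℝ)) ≤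
          ENNReal.ofReal (C * δ ^ (-ε)) *
            (∫⁻ y, ENNReal.ofReal |f y| ^ (n : ℝ)) ^ (1 / (n : ℝ)))
    {B : ℝ} (hB : 0 < B) :
    ∃ C' > (0:ℝ), ∀ s r a : ℝ, 0 < s → B * s < 1 → r + n * s ≤ B * s → 0 < a →
      ∀ w : (Fin n → ℤ) → ℝ≥0∞, (∀ Q, w Q ≠ ⊤) →
        μH[((n : ℝ) - 1)] {e ∈ Metric.sphere (0 : EuclideanSpace ℝ (Fin n)) 1 |
            ENNReal.ofReal a ≤ gridMax s r w e} ≤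
          ENNReal.ofReal (C' * (s ^ (-ε) / a) ^ n) * ∑' Q, w Q ^ n := by
  obtain ⟨V, hV, hvol⟩ := exists_volume_tube_le n
  have hn' : (n : ℝ) ≠ 0 := by positivity
  refine ⟨(C * B ^ (-ε) / (B / (V * B ^ n))) ^ n, by positivity, ?_⟩
  intro s r a hs hBs hr ha w hw
  have hδ : 0 < B * s := by positivity
  set ν : Measure (EuclideanSpace ℝ (Fin n)) := μH[((n : ℝ) - 1)] with hν
  set A := B / (V * B ^ n) * s with hA
  have hApos : 0 < A := by positivity
  set f : EuclideanSpace ℝ (Fin n) → ℝ := fun y => (w (gridIdx s y)).toReal with hf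
  have hfm : Measurable f :=
    (measurable_of_countable fun Q => (w Q).toReal).comp (measurable_gridIdx s)
  have hL := hyp (B * s) ⟨hδ, hBs⟩ f hfm
  have hfint : ∫⁻ y, ENNReal.ofReal |f y| ^ (n : ℝ) =
      ENNReal.ofReal (s ^ n) * ∑' Q, w Q ^ n := by
    have : ∀ y, ENNReal.ofReal |f y| ^ (n : ℝ) = w (gridIdx s y) ^ n := fun y => by
      rw [hf, abs_of_nonneg ENNReal.toReal_nonneg, ENNReal.ofReal_toReal (hw _),
        ENNReal.rpow_natCast]
    simp only [this]
    rw [lintegral_comp_gridIdx s volume (fun Q => w Q ^ n), ← ENNReal.tsum_mul_left]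
    refine tsum_congr fun Q => ?_
    rw [volume_gridIdx_preimage hs, ENNReal.ofReal_pow hs.le, mul_comm]
  rw [hfint] at hL
  have hL2 := ENNReal.rpow_le_rpow hL (Nat.cast_nonneg n : (0:ℝ) ≤ n)
  rw [ENNReal.mul_rpow_of_nonneg _ _ (Nat.cast_nonneg n), ← ENNReal.rpow_mul, ← ENNReal.rpow_mul,
    one_div_mul_cancel hn', ENNReal.rpow_one, ENNReal.rpow_one, ENNReal.rpow_natCast,
    ← ENNReal.ofReal_pow (by positivity), ← mul_assoc, ← ENNReal.ofReal_mul (by positivity)] at hL2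
  have hG : Measurable fun e => (ENNReal.ofReal A * gridMax s r w e) ^ (n : ℝ) :=
    ((measurable_gridMax s r w).const_mul _).pow_const _
  have hmarkov : ENNReal.ofReal ((A * a) ^ n) *
      ν {e ∈ Metric.sphere (0 : EuclideanSpace ℝ (Fin n)) 1 |
            ENNReal.ofReal a ≤ gridMax s r w e} ≤
      ∫⁻ e in Metric.sphere (0 : EuclideanSpace ℝ (Fin n)) 1, (kakeyaMax (B * s) f e) ^ (n : ℝ) ∂ν := by
    calc _ ≤ ENNReal.ofReal ((A * a) ^ n) * (ν.restrict (Metric.sphere 0 1))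
          {e | ENNReal.ofReal ((A * a) ^ n) ≤ (ENNReal.ofReal A * gridMax s r w e) ^ (n : ℝ)} := by
          refine mul_le_mul_right ?_ _
          rw [Measure.restrict_apply (measurableSet_le measurable_const hG)]
          refine measure_mono ?_
          rintro e ⟨he, hea⟩
          refine ⟨?_, he⟩
          rw [mem_ofPred_eq, ENNReal.rpow_natCast, ENNReal.ofReal_pow (by positivity),
            ENNReal.ofReal_mul hApos.le]
          gcongr
      _ ≤ ∫⁻ e in Metric.sphere (0 : EuclideanSpace ℝ (Fin n)) 1, (ENNReal.ofReal A * gridMax s r w e) ^ (n : ℝ) ∂ν :=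
          mul_meas_ge_le_lintegral hG _
      _ ≤ _ := by
          refine lintegral_mono_ae ?_
          filter_upwards [ae_restrict_mem isClosed_sphere.measurableSet] with e he
          refine ENNReal.rpow_le_rpow ?_ (Nat.cast_nonneg n)
          exact mul_gridMax_le_kakeyaMax hB hV hvol hs hBs hr w hw
            (mem_sphere_zero_iff_norm.1 he).le
  have hfin := hmarkov.trans hL2
  have hAa : 0 < (A * a) ^ n := by positivity
  rw [mul_comm, ← ENNReal.le_div_iff_mul_le (Or.inl (ENNReal.ofReal_pos.2 hAa).ne')
    (Or.inl ENNReal.ofReal_ne_top)] at hfin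
  refine hfin.trans (le_of_eq ?_)
  rw [ENNReal.mul_div_right_comm, ← ENNReal.ofReal_div_of_pos hAa]
  congr 2
  rw [hA, Real.mul_rpow hB.le hs.le, ← mul_pow, ← mul_pow, ← div_pow]
  congr 1
  field_simp

/-- A set of vanishing Hausdorff measure is covered by balls centred on it with small total
`p`-th power of the radii. -/
lemma exists_cover_of_hausdorffMeasure_eq_zero {X : Type*} [MetricSpace X] [MeasurableSpace X]
    [BorelSpace X] {p : ℝ} (hp : 0 < p) {A : Set X} (hA : μH[p] A = 0) {κ : ℝ≥0∞} (hκ : κ ≠ 0) :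
    ∃ (ι : Type) (u : ι → X) (d : ι → ℝ), (∀ i, u i ∈ A) ∧ (∀ i, 0 < d i) ∧
      (∀ y ∈ A, ∃ i, dist (u i) y ≤ d i) ∧ ∑' i, ENNReal.ofReal (d i ^ p) ≤ κ := by
  have hκ2 : κ / 2 ≠ 0 := (ENNReal.half_pos hκ).ne'
  rw [Measure.hausdorffMeasure_apply, ENNReal.iSup_eq_zero] at hA
  have h1 := ENNReal.iSup_eq_zero.1 (hA 1) one_pos
  have h2 := (h1.le.trans_lt (pos_iff_ne_zero.2 hκ2))
  simp only [iInf_lt_iff] at h2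
  obtain ⟨t, htA, htd, hts⟩ := h2
  obtain ⟨ε, hε, hεs⟩ := ENNReal.exists_pos_sum_of_countable hκ2 ℕ
  have hfin : ∀ i, Metric.ediam (t i) ≠ ⊤ := fun i => ((htd i).trans_lt ENNReal.one_lt_top).ne
  have hx : ∀ i : {i // (t i ∩ A).Nonempty}, ∃ x, x ∈ t i ∩ A := fun i => i.2
  choose u hu using hx
  have hpos : ∀ i : ℕ, 0 < (Metric.ediam (t i)).toReal ^ p + ε i := fun i =>
    add_pos_of_nonneg_of_pos (by positivity) (hε i)
  refine ⟨{i // (t i ∩ A).Nonempty}, u,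
    fun i => ((Metric.ediam (t i)).toReal ^ p + ε i) ^ (p⁻¹), fun i => (hu i).2,
    fun i => Real.rpow_pos_of_pos (hpos i) _, ?_, ?_⟩
  · intro y hy
    obtain ⟨i, hi⟩ := mem_iUnion.1 (htA hy)
    refine ⟨⟨i, y, hi, hy⟩, ?_⟩
    have h3 : dist (u ⟨i, y, hi, hy⟩) y ≤ (Metric.ediam (t i)).toReal := by
      rw [dist_edist]
      exact ENNReal.toReal_mono (hfin i) (Metric.edist_le_ediam_of_mem (hu ⟨i, y, hi, hy⟩).1 hi)
    refine h3.trans ?_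
    rw [Real.le_rpow_inv_iff_of_pos ENNReal.toReal_nonneg (hpos i).le hp]
    exact le_add_of_nonneg_right (ε i).coe_nonneg
  · calc ∑' i : {i // (t i ∩ A).Nonempty},
          ENNReal.ofReal ((((Metric.ediam (t i)).toReal ^ p + ε i) ^ (p⁻¹)) ^ p)
        ≤ ∑' i : {i // (t i ∩ A).Nonempty},
          ((⨆ _ : (t i).Nonempty, Metric.ediam (t i) ^ p) + (ε i : ℝ≥0∞)) := by
          refine ENNReal.tsum_le_tsum fun i => ?_
          rw [Real.rpow_inv_rpow (hpos i).le hp.ne', ENNReal.ofReal_add (by positivity) (ε i).coe_nonneg,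
            ENNReal.ofReal_coe_nnreal, ← ENNReal.ofReal_rpow_of_nonneg ENNReal.toReal_nonneg hp.le,
            ENNReal.ofReal_toReal (hfin i)]
          gcongr
          exact le_iSup (fun _ : (t i).Nonempty => Metric.ediam (t i) ^ p)
            (i.2.mono inter_subset_left)
      _ ≤ ∑' i : ℕ, ((⨆ _ : (t i).Nonempty, Metric.ediam (t i) ^ p) + (ε i : ℝ≥0∞)) :=
          ENNReal.tsum_comp_le_tsum_of_injective Subtype.val_injective _
      _ = _ + _ := ENNReal.tsum_add
      _ ≤ κ / 2 + κ / 2 := add_le_add hts.le hεs.le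
      _ = κ := ENNReal.add_halves κ

namespace IsQSGauge

variable {η : ℝ → ℝ}

lemma nonneg (hη : IsQSGauge η) {t : ℝ} (ht : 0 ≤ t) : 0 ≤ η t := hη.2.2.2.1 ht

lemma mono (hη : IsQSGauge η) {s t : ℝ} (hs : 0 ≤ s) (hst : s ≤ t) : η s ≤ η t :=
  hη.2.1.monotoneOn hs (hs.trans hst) hst

lemma pos (hη : IsQSGauge η) {t : ℝ} (ht : 0 < t) : 0 < η t := by
  have := hη.2.1 (mem_Ici.2 (le_refl (0:ℝ))) ht.le ht
  rwa [hη.1] at this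

lemma exists_le_half (hη : IsQSGauge η) : ∃ l : ℝ, 0 < l ∧ l ≤ 1 / 2 ∧ η l ≤ 1 / 2 := by
  obtain ⟨t, ht, ht2⟩ := hη.2.2.2.2 (show (1 / 2 : ℝ) ∈ Ici 0 by norm_num)
  have ht0 : 0 < t := by
    rcases (mem_Ici.1 ht).eq_or_lt with h | h
    · rw [← h, hη.1] at ht2; norm_num at ht2
    · exact h
  refine ⟨min t (1 / 2), by positivity, min_le_right _ _, ?_⟩
  exact (hη.mono (by positivity) (min_le_left _ _)).trans ht2.le

end IsQSGauge

lemma IsQSOn.continuousOn {X Y : Type*} [MetricSpace X] [MetricSpace Y] {η : ℝ → ℝ}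
    (hη : IsQSGauge η) {g : X → Y} {K : Set X} (hqs : IsQSOn η g K)
    (hK : ∀ x ∈ K, ∃ z ∈ K, x ≠ z) : ContinuousOn g K := by
  intro x hx
  obtain ⟨z, hz, hxz⟩ := hK x hx
  have h1 : ContinuousOn (fun y => η (dist x y / dist x z) * dist (g x) (g z)) K := by
    refine ContinuousOn.mul ?_ continuousOn_const
    exact hη.2.2.1.comp (by fun_prop) fun y _ => div_nonneg dist_nonneg dist_nonneg
  have h2 := h1 x hx
  rw [ContinuousWithinAt] at h2 ⊢
  simp only [dist_self, zero_div, hη.1, zero_mul] at h2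
  rw [tendsto_iff_dist_tendsto_zero]
  refine squeeze_zero' (Filter.Eventually.of_forall fun _ => dist_nonneg) ?_ h2
  filter_upwards [self_mem_nhdsWithin] with y hy
  rw [dist_comm]
  exact hqs x hx y hy z hz hxz

/-- Around every point of a uniformly perfect set, a small ball in the image of a quasisymmetric
map is comparable to the image of a ball whose radius lies in a given geometric progression. -/
lemma IsQSOn.exists_scale {X Y : Type*} [MetricSpace X] [MetricSpace Y] {η : ℝ → ℝ}
    (hη : IsQSGauge η) {g : X → Y} {K : Set X} (hqs : IsQSOn η g K) {c M q σ : ℝ}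
    (hc : 0 < c) (hq : 0 < q) (hηq : η q ≤ 1 / 2) (hσ : 0 < σ)
    (hsep : ∀ x ∈ K, ∃ a ∈ K, dist x a ≤ 1 ∧ c ≤ dist (g x) (g a))
    (hz : ∀ x ∈ K, ∃ z : ℕ → X, ∀ j, z j ∈ K ∧ dist x (z j) = σ / 2 * q ^ j ∧
      dist (g x) (g (z j)) ≤ M) :
    ∃ τ > 0, ∀ x ∈ K, ∀ d, 0 < d → d < τ → ∃ l : ℕ, d ≤ 2 * M * (1 / 2) ^ l ∧
      (∀ y ∈ K, dist (g x) (g y) ≤ d → dist x y ≤ (q ^ 2)⁻¹ * (σ * q ^ l)) ∧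
      ∀ R ≥ 0, ∀ y ∈ K, dist x y ≤ R * (σ * q ^ l) → dist (g x) (g y) ≤ η (2 * R) * d := by
  have hη2 := hη.pos (show 0 < 2 / σ by positivity)
  refine ⟨c / η (2 / σ), by positivity, fun x hx d hd hdτ => ?_⟩
  obtain ⟨z, hzs⟩ := hz x hx
  have hne : ∀ j, x ≠ z j := fun j => by
    rw [← dist_pos, (hzs j).2.1]; positivity
  have hdecay : ∀ j, dist (g x) (g (z j)) ≤ M * (1 / 2) ^ j := by
    intro j
    induction j with
    | zero => simpa using (hzs 0).2.2
    | succ j ih =>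
      have h := hqs x hx _ (hzs (j + 1)).1 _ (hzs j).1 (hne j)
      have e : dist x (z (j + 1)) / dist x (z j) = q := by
        rw [(hzs _).2.1, (hzs _).2.1]; field_simp; ring
      rw [e] at h
      calc _ ≤ _ := h
        _ ≤ 1 / 2 * (M * (1 / 2) ^ j) := mul_le_mul hηq ih dist_nonneg (by norm_num)
        _ = _ := by ring
  have hex : ∃ j, dist (g x) (g (z j)) ≤ d := by
    have hM : Filter.Tendsto (fun j : ℕ => M * (1 / 2 : ℝ) ^ j) Filter.atTop (nhds (M * 0)) :=
      (_root_.tendsto_pow_atTop_nhds_zero_of_lt_one (by norm_num) (by norm_num)).const_mul M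
    rw [mul_zero] at hM
    obtain ⟨j, hj⟩ := (hM.eventually (gt_mem_nhds hd)).exists
    exact ⟨j, (hdecay j).trans hj.le⟩
  classical
  have hspec := Nat.find_spec hex
  have hmin : ∀ m < Nat.find hex, d < dist (g x) (g (z m)) := fun m hm =>
    not_le.1 (Nat.find_min hex hm)
  have h0 : Nat.find hex ≠ 0 := by
    intro h0
    rw [h0] at hspec
    obtain ⟨a, ha, hxa, hca⟩ := hsep x hx
    have h := hqs x hx a ha _ (hzs 0).1 (hne 0)
    have h3 : η (dist x a / dist x (z 0)) ≤ η (2 / σ) := by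
      refine hη.mono (by positivity) ?_
      rw [(hzs 0).2.1, pow_zero, mul_one, div_le_div_iff₀ (by positivity) hσ]
      nlinarith
    rw [lt_div_iff₀ hη2] at hdτ
    nlinarith [mul_le_mul_of_nonneg_right h3 (dist_nonneg (x := g x) (y := g (z 0))),
      mul_le_mul_of_nonneg_left hspec hη2.le]
  obtain ⟨m, hm⟩ := Nat.exists_eq_succ_of_ne_zero h0
  rw [hm] at hspec hmin
  have hlt := hmin m (Nat.lt_succ_self m)
  refine ⟨m + 1, ?_, ?_, ?_⟩
  · calc d ≤ M * (1 / 2) ^ m := hlt.le.trans (hdecay m)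
      _ = _ := by ring
  · intro y hy hyd
    by_contra! hcon
    have e : (q ^ 2)⁻¹ * (σ * q ^ (m + 1)) = σ * q ^ m / q := by field_simp; ring
    rw [e, div_lt_iff₀ hq] at hcon
    have hxy : 0 < dist x y := by
      by_contra! h
      have : 0 < σ * q ^ m := by positivity
      nlinarith
    have h := hqs x hx _ (hzs m).1 y hy (dist_pos.1 hxy)
    have h3 : η (dist x (z m) / dist x y) ≤ η q := by
      refine hη.mono (by positivity) ?_
      rw [(hzs m).2.1, div_le_iff₀ hxy]
      have : 0 < σ * q ^ m := by positivity
      nlinarith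
    have h4 := mul_le_mul (h3.trans hηq) hyd dist_nonneg (by norm_num)
    linarith
  · intro R hR y hy hxy
    refine (hqs x hx y hy _ (hzs (m + 1)).1 (hne _)).trans ?_
    refine mul_le_mul (hη.mono (by positivity) ?_) hspec dist_nonneg (hη.nonneg (by positivity))
    rw [(hzs (m + 1)).2.1, div_le_iff₀ (by positivity)]
    linarith

/-- The weights of the cells near a segment control the length of the image of the segment. -/
lemma le_tsum_gridMax {n : ℕ} {X : Type*} [MetricSpace X] {K : Set (EuclideanSpace ℝ (Fin n))}
    {g : EuclideanSpace ℝ (Fin n) → X} (hg : ContinuousOn g K)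
    {e x : EuclideanSpace ℝ (Fin n)} (hex : seg e x ⊆ K) {c : ℝ}
    (hce : c ≤ dist (g x) (g (x + e))) {ι : Type*} {u : ι → EuclideanSpace ℝ (Fin n)}
    {d : ι → ℝ}
    (hcov : ∀ y ∈ K, ∃ i, dist (g (u i)) (g y) ≤ d i) {l : ι → ℕ} {s : ℕ → ℝ} (hs : ∀ k, 0 < s k)
    {β L : ℝ} (hL : 0 ≤ L)
    (hfar : ∀ i, ∀ y ∈ K, dist (g (u i)) (g y) ≤ d i → dist (u i) y ≤ β * s (l i))
    (hnear : ∀ i, ∀ y ∈ K, dist (u i) y ≤ (β + 1 + 2 * n) * s (l i) →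
      dist (g (u i)) (g y) ≤ L * d i)
    {w : ℕ → (Fin n → ℤ) → ℝ≥0∞}
    (hw : ∀ i, ENNReal.ofReal (d i) ≤ w (l i) (gridIdx (s (l i)) (u i))) :
    ENNReal.ofReal c ≤
      ENNReal.ofReal (2 * L) * ∑' k, gridMax (s k) ((β + 1 + n) * s k) (w k) e := by
  set f : ℝ → ℝ := fun t => dist (g x) (g (x + t • e)) with hf
  have hfc : ContinuousOn f (Icc 0 1) := by
    refine continuous_dist.comp_continuousOn (continuousOn_const.prodMk
      (hg.comp (f := fun t : ℝ => x + t • e) (by fun_prop) ?_))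
    exact fun t ht => hex ⟨t, ht, rfl⟩
  set G : ℕ → (Fin n → ℤ) → Set ℝ := fun k Q =>
    {v | ∃ i, l i = k ∧ gridIdx (s k) (u i) = Q ∧ ∃ t ∈ Icc (0:ℝ) 1,
      dist (gridPt (s k) Q) (x + t • e) < (β + 1 + n) * s k ∧ f t = v} with hG
  have hsub : Icc 0 c ⊆ ⋃ k, ⋃ Q, G k Q := by
    intro v hv
    have h1 := intermediate_value_Icc (zero_le_one' ℝ) hfc
    have h2 : v ∈ Icc (f 0) (f 1) := by
      simp only [hf, zero_smul, add_zero, dist_self, one_smul]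
      exact ⟨hv.1, hv.2.trans hce⟩
    obtain ⟨t, ht, htv⟩ := h1 h2
    have hy : x + t • e ∈ K := hex ⟨t, ht, rfl⟩
    obtain ⟨i, hi⟩ := hcov _ hy
    refine mem_iUnion₂.2 ⟨l i, gridIdx (s (l i)) (u i), i, rfl, rfl, t, ht, ?_, htv⟩
    have h3 := hfar i _ hy hi
    have h4 := dist_gridPt_gridIdx_le (hs (l i)) (u i)
    rw [dist_comm] at h4
    linarith [dist_triangle (gridPt (s (l i)) (gridIdx (s (l i)) (u i))) (u i) (x + t • e),
      hs (l i)]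
  have hvol : ∀ k Q, volume (G k Q) ≤ ENNReal.ofReal (2 * L) *
      (nearDirs ((β + 1 + n) * s k) (gridPt (s k) Q) x).indicator (fun _ => w k Q) e := by
    intro k Q
    rcases (G k Q).eq_empty_or_nonempty with h | ⟨v, i, rfl, rfl, t, ht, htd, -⟩
    · rw [h]; simp
    · have he : e ∈ nearDirs ((β + 1 + n) * s (l i))
          (gridPt (s (l i)) (gridIdx (s (l i)) (u i))) x := ⟨t, ht, htd⟩
      rw [indicator_of_mem he]
      have hball : G (l i) (gridIdx (s (l i)) (u i)) ⊆
          closedBall (dist (g x) (g (u i))) (L * d i) := by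
        rintro v ⟨j, hj, hjQ, t', ht', htd', rfl⟩
        have h4 := dist_gridPt_gridIdx_le (hs (l i)) (u i)
        have h5 := hnear i _ (hex ⟨t', ht', rfl⟩) (by
          linarith [dist_triangle (u i) (gridPt (s (l i)) (gridIdx (s (l i)) (u i)))
            (x + t' • e)])
        rw [mem_closedBall, Real.dist_eq]
        simp only [hf]
        have h6 := dist_triangle (g x) (g (u i)) (g (x + t' • e))
        have h7 := dist_triangle_right (g x) (g (u i)) (g (x + t' • e))
        exact abs_sub_le_iff.2 ⟨by linarith, by linarith⟩
      refine (measure_mono hball).trans ?_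
      rw [Real.volume_closedBall, ← mul_assoc, ENNReal.ofReal_mul (by positivity)]
      exact mul_le_mul_right (hw i) _
  calc ENNReal.ofReal c = volume (Icc 0 c) := by simp
    _ ≤ ∑' k, ∑' Q, volume (G k Q) :=
        (measure_mono hsub).trans ((measure_iUnion_le _).trans
          (ENNReal.tsum_le_tsum fun k => measure_iUnion_le _))
    _ ≤ ∑' k, ∑' Q, ENNReal.ofReal (2 * L) *
          (nearDirs ((β + 1 + n) * s k) (gridPt (s k) Q) x).indicator (fun _ => w k Q) e :=
        ENNReal.tsum_le_tsum fun k => ENNReal.tsum_le_tsum fun Q => hvol k Q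
    _ ≤ _ := by
        simp only [ENNReal.tsum_mul_left]
        refine mul_le_mul_right (ENNReal.tsum_le_tsum fun k => ?_) _
        exact le_iSup (fun x => ∑' Q,
          (nearDirs ((β + 1 + n) * s k) (gridPt (s k) Q) x).indicator (fun _ => w k Q) e) x

lemma exists_seg_far_point {n : ℕ} {X : Type*} [MetricSpace X]
    {g : EuclideanSpace ℝ (Fin n) → X} {e x y : EuclideanSpace ℝ (Fin n)} (he : ‖e‖ = 1)
    (hy : y ∈ seg e x) {c : ℝ} (hc : c ≤ dist (g x) (g (x + e))) :
    ∃ a ∈ seg e x, dist y a ≤ 1 ∧ c / 2 ≤ dist (g y) (g a) := by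
  obtain ⟨t, ht, rfl⟩ := hy
  have h0 : x ∈ seg e x := ⟨0, ⟨le_rfl, zero_le_one⟩, by simp⟩
  have h1 : x + e ∈ seg e x := ⟨1, ⟨zero_le_one, le_rfl⟩, by simp⟩
  by_cases h : c / 2 ≤ dist (g (x + t • e)) (g x)
  · refine ⟨x, h0, ?_, h⟩
    simp only [dist_self_add_left, norm_smul, he, mul_one, Real.norm_eq_abs, abs_of_nonneg ht.1]
    exact ht.2
  · refine ⟨x + e, h1, ?_, ?_⟩
    · simp only [dist_add_left]
      rw [dist_comm, dist_eq_norm]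
      nth_rewrite 1 [← one_smul ℝ e]
      rw [← sub_smul, norm_smul, he, mul_one, Real.norm_eq_abs, abs_of_nonneg (by linarith [ht.2])]
      linarith [ht.1]
    · linarith [dist_triangle_left (g x) (g (x + e)) (g (x + t • e)), not_le.1 h]

lemma exists_seg_dist_eq {n : ℕ} {e x y : EuclideanSpace ℝ (Fin n)} (he : ‖e‖ = 1)
    (hy : y ∈ seg e x) {r : ℝ} (hr : 0 ≤ r) (hr2 : r ≤ 1 / 2) :
    ∃ z ∈ seg e x, dist y z = r := by
  obtain ⟨t, ht, rfl⟩ := hy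
  have key : ∀ t' : ℝ, dist (x + t • e) (x + t' • e) = |t - t'| := fun t' => by
    rw [dist_add_left, dist_eq_norm, ← sub_smul, norm_smul, he, mul_one, Real.norm_eq_abs]
  by_cases h : t ≤ 1 / 2
  · refine ⟨x + (t + r) • e, ⟨t + r, ⟨by linarith [ht.1], by linarith⟩, rfl⟩, ?_⟩
    simp only [key]
    rw [sub_add_cancel_left, abs_neg, abs_of_nonneg hr]
  · refine ⟨x + (t - r) • e, ⟨t - r, ⟨by linarith, by linarith [ht.2]⟩, rfl⟩, ?_⟩
    simp only [key]
    rw [_root_.sub_sub_cancel, abs_of_nonneg hr]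

lemma IsQSOn.dist_le_of_mem_seg {n : ℕ} {X : Type*} [MetricSpace X] {η : ℝ → ℝ}
    (hη : IsQSGauge η) {K : Set (EuclideanSpace ℝ (Fin n))}
    {g : EuclideanSpace ℝ (Fin n) → X} (hqs : IsQSOn η g K)
    {e x y z : EuclideanSpace ℝ (Fin n)} (he : ‖e‖ = 1) (hK : seg e x ⊆ K)
    (hy : y ∈ seg e x) (hz : z ∈ seg e x) :
    dist (g y) (g z) ≤ 2 * η 1 * dist (g x) (g (x + e)) := by
  have h0 : x ∈ K := hK ⟨0, ⟨le_rfl, zero_le_one⟩, by simp⟩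
  have h1 : x + e ∈ K := hK ⟨1, ⟨zero_le_one, le_rfl⟩, by simp⟩
  have hd : dist x (x + e) = 1 := by simp [he]
  have key : ∀ y ∈ seg e x, dist (g x) (g y) ≤ η 1 * dist (g x) (g (x + e)) := by
    intro y hy
    refine (hqs x h0 y (hK hy) _ h1 (by rw [← dist_pos, hd]; exact one_pos)).trans ?_
    refine mul_le_mul_of_nonneg_right (hη.mono (by positivity) ?_) dist_nonneg
    obtain ⟨t, ht, rfl⟩ := hy
    rw [hd, div_one, dist_self_add_right, norm_smul, he, mul_one, Real.norm_eq_abs,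
      abs_of_nonneg ht.1]
    exact ht.2
  linarith [dist_triangle_left (g y) (g z) (g x), key y hy, key z hz]

/-- Quantitative form of the main result: the set of directions whose segments have images of
size between two fixed bounds is null if the image has vanishing `p`-dimensional measure. -/
lemma hausdorffMeasure_directions_eq_zero {n : ℕ} (hn : 0 < n)
    (hyp : ∀ ε > (0:ℝ), ∃ C > (0:ℝ), ∀ δ ∈ Set.Ioo (0:ℝ) 1,
      ∀ f : EuclideanSpace ℝ (Fin n) → ℝ, Measurable f →
        (∫⁻ e in Metric.sphere (0 : EuclideanSpace ℝ (Fin n)) 1,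
            (kakeyaMax δ f e) ^ (n : ℝ) ∂(μH[((n : ℝ) - 1)])) ^ (1 / (n : ℝ)) ≤
          ENNReal.ofReal (C * δ ^ (-ε)) *
            (∫⁻ y, ENNReal.ofReal |f y| ^ (n : ℝ)) ^ (1 / (n : ℝ)))
    {X : Type*} [MetricSpace X] [MeasurableSpace X] [BorelSpace X]
    {K S : Set (EuclideanSpace ℝ (Fin n))}
    (hS : S ⊆ Metric.sphere (0 : EuclideanSpace ℝ (Fin n)) 1)
    {g : EuclideanSpace ℝ (Fin n) → X} {η : ℝ → ℝ} (hη : IsQSGauge η) (hqs : IsQSOn η g K)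
    {c M : ℝ} (hc : 0 < c) (hM : 0 < M)
    (hKak : ∀ e ∈ S, ∃ x, seg e x ⊆ K ∧ c ≤ dist (g x) (g (x + e)) ∧
      dist (g x) (g (x + e)) ≤ M)
    {p : ℝ} (hp : 0 < p) (hpn : p < n) (hdim : μH[p] (g '' K) = 0) :
    μH[((n : ℝ) - 1)] S = 0 := by
  have hn0 : (0:ℝ) < n := by exact_mod_cast hn
  set K' : Set (EuclideanSpace ℝ (Fin n)) := {y | ∃ e ∈ S, ∃ x, seg e x ⊆ K ∧
    c ≤ dist (g x) (g (x + e)) ∧ dist (g x) (g (x + e)) ≤ M ∧ y ∈ seg e x} with hK'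
  have hK'K : K' ⊆ K := by
    rintro y ⟨e, he, x, hx, -, -, hy⟩
    exact hx hy
  have hqs' : IsQSOn η g K' := fun x hx y hy z hz =>
    hqs x (hK'K hx) y (hK'K hy) z (hK'K hz)
  have hdim' : μH[p] (g '' K') = 0 := measure_mono_null (image_mono hK'K) hdim
  have hnorm : ∀ e ∈ S, ‖e‖ = 1 := fun e he => mem_sphere_zero_iff_norm.1 (hS he)
  obtain ⟨q, hq, hq2, hηq⟩ := hη.exists_le_half
  set ρ : ℝ := (1 / 2) ^ ((n - p) / (2 * n)) with hρ
  have hρ0 : 0 < ρ := by positivity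
  have hρ1 : ρ < 1 := Real.rpow_lt_one (by norm_num) (by norm_num)
    (div_pos (by linarith) (by positivity))
  have hqρ : q ^ Real.logb q ρ = ρ := Real.rpow_logb hq (by linarith) hρ0
  have hε : 0 < Real.logb q ρ :=
    Real.logb_pos_of_base_lt_one hq (by linarith) hρ0 hρ1
  set ε := Real.logb q ρ with hεdef
  obtain ⟨C, hC, hypC⟩ := hyp ε hε
  set β : ℝ := (q ^ 2)⁻¹ with hβ
  have hβ0 : 0 < β := by positivity
  set B : ℝ := β + 1 + 2 * n with hB
  have hB0 : 0 < B := by positivity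
  obtain ⟨C', hC', hweak⟩ := exists_measure_gridMax_ge_le hn hC hypC hB0
  set σ : ℝ := 1 / (B + 1) with hσ
  have hσ0 : 0 < σ := by positivity
  have hσ1 : σ ≤ 1 := by rw [hσ, div_le_one (by positivity)]; linarith
  have hBσ : B * σ < 1 := by rw [hσ, mul_one_div, div_lt_one (by positivity)]; linarith
  set L : ℝ := η (2 * B) with hL
  have hL0 : 0 < L := hη.pos (by positivity)
  set a₀ : ℝ := c * (1 - ρ) / (4 * L) with ha₀
  have ha₀0 : 0 < a₀ := div_pos (mul_pos hc (by linarith)) (by positivity)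
  set M' : ℝ := 2 * η 1 * M with hM'
  have hη1 := hη.pos one_pos
  have hM'0 : 0 < M' := by positivity
  have hqpow : ∀ j : ℕ, q ^ j ≤ 1 := fun j => pow_le_one₀ hq.le (by linarith)
  have hzK : ∀ y ∈ K', ∃ z : ℕ → EuclideanSpace ℝ (Fin n), ∀ j, z j ∈ K' ∧
      dist y (z j) = σ / 2 * q ^ j ∧ dist (g y) (g (z j)) ≤ M' := by
    rintro y ⟨e, he, x, hx, hcx, hMx, hy⟩
    have h : ∀ j : ℕ, ∃ z ∈ seg e x, dist y z = σ / 2 * q ^ j := fun j => by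
      refine exists_seg_dist_eq (hnorm e he) hy (by positivity) ?_
      have := hqpow j
      nlinarith [pow_pos hq j]
    choose z hz hzd using h
    refine ⟨z, fun j => ⟨⟨e, he, x, hx, hcx, hMx, hz j⟩, hzd j, ?_⟩⟩
    refine (hqs.dist_le_of_mem_seg hη (hnorm e he) hx hy (hz j)).trans ?_
    rw [hM']
    gcongr
  have hsep : ∀ y ∈ K', ∃ a ∈ K', dist y a ≤ 1 ∧ c / 2 ≤ dist (g y) (g a) := by
    rintro y ⟨e, he, x, hx, hcx, hMx, hy⟩
    obtain ⟨a, ha, h1, h2⟩ := exists_seg_far_point (g := g) (hnorm e he) hy hcx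
    exact ⟨a, ⟨e, he, x, hx, hcx, hMx, ha⟩, h1, h2⟩
  have hcont : ContinuousOn g K' := by
    refine hqs'.continuousOn hη fun y hy => ?_
    obtain ⟨z, hz⟩ := hzK y hy
    refine ⟨z 0, (hz 0).1, ?_⟩
    rw [← dist_pos, (hz 0).2.1]
    positivity
  obtain ⟨τ, hτ, hscale⟩ := hqs'.exists_scale hη (half_pos hc) hq hηq hσ0 hsep hzK
  set s : ℕ → ℝ := fun k => σ * q ^ k with hs
  have hs0 : ∀ k, 0 < s k := fun k => by positivity
  set T : ℝ := C' * (σ ^ (-ε) / a₀) ^ n * (2 * M') ^ (n - p) with hT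
  have hmain : ∀ κ : ℝ, 0 < κ → κ < τ ^ p →
      μH[((n : ℝ) - 1)] S ≤ ENNReal.ofReal (T * κ) := by
    intro κ hκ hκτ
    obtain ⟨ι, v, d, hv, hd, hcov, hsum⟩ := exists_cover_of_hausdorffMeasure_eq_zero hp hdim'
      (ENNReal.ofReal_pos.2 hκ).ne'
    choose u hu huv using hv
    have hdτ : ∀ i, d i < τ := by
      intro i
      have h1 := (ENNReal.ofReal_le_ofReal_iff hκ.le).1 ((ENNReal.le_tsum i).trans hsum)
      exact (Real.rpow_lt_rpow_iff (hd i).le hτ.le hp).1 (h1.trans_lt hκτ)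
    have hl := fun i => hscale (u i) (hu i) (d i) (hd i) (hdτ i)
    choose l hl1 hl2 hl3 using hl
    set W : ℕ → (Fin n → ℤ) → ℝ≥0∞ := fun k Q =>
      ∑' i, if l i = k then if gridIdx (s k) (u i) = Q then ENNReal.ofReal (d i ^ n) else 0
        else 0 with hW
    set w : ℕ → (Fin n → ℤ) → ℝ≥0∞ := fun k Q => W k Q ^ ((n : ℝ)⁻¹) with hw
    have hwn : ∀ k Q, w k Q ^ n = W k Q := fun k Q => by
      rw [hw, ← ENNReal.rpow_natCast, ← ENNReal.rpow_mul, inv_mul_cancel₀ hn0.ne',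
        ENNReal.rpow_one]
    have hlevel : ∀ k, ∑' Q, w k Q ^ n ≤ ENNReal.ofReal ((2 * M' * (1 / 2) ^ k) ^ (n - p)) *
        ∑' i, if l i = k then ENNReal.ofReal (d i ^ p) else 0 := by
      intro k
      simp only [hwn, hW]
      rw [ENNReal.tsum_comm, ← ENNReal.tsum_mul_left]
      refine ENNReal.tsum_le_tsum fun i => ?_
      split_ifs with hik
      · rw [tsum_eq_single (gridIdx (s k) (u i)) (fun Q hQ => if_neg hQ.symm), if_pos rfl,
          ← ENNReal.ofReal_mul (by positivity)]
        refine ENNReal.ofReal_le_ofReal ?_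
        calc d i ^ n = d i ^ ((n:ℝ) - p) * d i ^ p := by
              rw [← Real.rpow_add (hd i), sub_add_cancel, Real.rpow_natCast]
          _ ≤ _ := by
              have := hl1 i
              rw [hik] at this
              have hdi := hd i
              gcongr
      · simp
    have hsumlevel : ∑' k, ∑' i, (if l i = k then ENNReal.ofReal (d i ^ p) else 0) ≤
        ENNReal.ofReal κ := by
      rw [ENNReal.tsum_comm]
      refine le_trans (le_of_eq (tsum_congr fun i => ?_)) hsum
      rw [tsum_eq_single (l i) (fun k hk => if_neg hk.symm), if_pos rfl]
    have hwfin : ∀ k Q, w k Q ≠ ⊤ := by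
      intro k Q
      have h1 : w k Q ^ n ≠ ⊤ := by
        exact (((ENNReal.le_tsum Q).trans (hlevel k)).trans_lt
          (ENNReal.mul_lt_top ENNReal.ofReal_lt_top
            (((ENNReal.le_tsum k).trans hsumlevel).trans_lt ENNReal.ofReal_lt_top))).ne
      exact fun h => h1 (by rw [h, ENNReal.top_pow hn.ne'])
    have hwd : ∀ i, ENNReal.ofReal (d i) ≤ w (l i) (gridIdx (s (l i)) (u i)) := by
      intro i
      simp only [hw, hW]
      rw [ENNReal.le_rpow_inv_iff hn0, ENNReal.rpow_natCast, ← ENNReal.ofReal_pow (hd i).le]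
      refine le_trans (le_of_eq ?_) (ENNReal.le_tsum i)
      simp
    have hcover : S ⊆ ⋃ k, {e ∈ Metric.sphere (0 : EuclideanSpace ℝ (Fin n)) 1 |
        ENNReal.ofReal (a₀ * ρ ^ k) ≤ gridMax (s k) ((β + 1 + n) * s k) (w k) e} := by
      intro e he
      by_contra hcon
      simp only [mem_iUnion, mem_ofPred_eq, not_exists, not_and, not_le] at hcon
      obtain ⟨x, hx, hcx, hMx⟩ := hKak e he
      have hseg : seg e x ⊆ K' := fun y hy => ⟨e, he, x, hx, hcx, hMx, hy⟩
      have h1 := le_tsum_gridMax hcont hseg hcx (d := d) (l := l) (s := s) (w := w)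
        (fun y hy => by
          obtain ⟨i, hi⟩ := hcov (g y) (mem_image_of_mem g hy)
          exact ⟨i, by rwa [huv i]⟩) hs0 hL0.le hl2 (fun i => hl3 i B hB0.le) hwd
      have h2 : ∑' k, gridMax (s k) ((β + 1 + n) * s k) (w k) e ≤
          ENNReal.ofReal (a₀ * (1 - ρ)⁻¹) := by
        have hgeo := (hasSum_geometric_of_lt_one hρ0.le hρ1).mul_left a₀
        rw [← hgeo.tsum_eq, ENNReal.ofReal_tsum_of_nonneg (fun k => by positivity) hgeo.summable]
        exact ENNReal.tsum_le_tsum fun k => (hcon k (hS he)).le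
      have h3 := h1.trans (mul_le_mul_right h2 _)
      rw [← ENNReal.ofReal_mul (by positivity), ENNReal.ofReal_le_ofReal_iff (mul_nonneg
        (by positivity) (mul_nonneg ha₀0.le (inv_nonneg.2 (by linarith))))] at h3
      have h4 : 2 * L * (a₀ * (1 - ρ)⁻¹) = c / 2 := by
        have : 1 - ρ ≠ 0 := by linarith
        rw [ha₀]; field_simp; norm_num
      linarith
    have hterm : ∀ k, μH[((n : ℝ) - 1)] {e ∈ Metric.sphere (0 : EuclideanSpace ℝ (Fin n)) 1 |
        ENNReal.ofReal (a₀ * ρ ^ k) ≤ gridMax (s k) ((β + 1 + n) * s k) (w k) e} ≤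
        ENNReal.ofReal T * ∑' i, if l i = k then ENNReal.ofReal (d i ^ p) else 0 := by
      intro k
      have h1 := hweak (s k) ((β + 1 + n) * s k) (a₀ * ρ ^ k) (hs0 k) (by
        have := hqpow k
        calc B * s k = B * σ * q ^ k := by rw [hs]; ring
          _ ≤ B * σ * 1 := by gcongr
          _ < 1 := by linarith) (by rw [hB]; linarith) (by positivity) (w k) (hwfin k)
      refine h1.trans ((mul_le_mul_right (hlevel k) _).trans (le_of_eq ?_))
      rw [← mul_assoc, ← ENNReal.ofReal_mul (by positivity)]
      congr 2
      have e1 : s k ^ (-ε) = σ ^ (-ε) * (ρ ^ k)⁻¹ := by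
        rw [hs, Real.mul_rpow hσ0.le (by positivity), Real.rpow_neg (by positivity) (y := ε),
          Real.rpow_neg (by positivity) (y := ε), ← Real.rpow_natCast, ← Real.rpow_mul hq.le,
          mul_comm (k : ℝ), Real.rpow_mul hq.le, hqρ, Real.rpow_natCast]
      have e2 : ((1 / 2 : ℝ) ^ k) ^ ((n:ℝ) - p) = ((ρ ^ k) ^ 2) ^ n := by
        have h2 : (0:ℝ) ≤ 1 / 2 := by norm_num
        rw [hρ, ← pow_mul, ← pow_mul, ← Real.rpow_natCast, ← Real.rpow_natCast,
          ← Real.rpow_mul h2, ← Real.rpow_mul h2]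
        congr 1
        push_cast
        field_simp
      rw [e1, Real.mul_rpow (x := 2 * M') (by positivity) (by positivity), e2, hT]
      have hρk : 0 < ρ ^ k := by positivity
      have e3 : (σ ^ (-ε) * (ρ ^ k)⁻¹ / (a₀ * ρ ^ k)) ^ n * ((ρ ^ k) ^ 2) ^ n =
          (σ ^ (-ε) / a₀) ^ n := by
        rw [← mul_pow]
        congr 1
        field_simp
      rw [← e3]
      ring
    calc μH[((n : ℝ) - 1)] S ≤ _ := (measure_mono hcover).trans (measure_iUnion_le _)
      _ ≤ ∑' k, ENNReal.ofReal T * ∑' i, if l i = k then ENNReal.ofReal (d i ^ p) else 0 :=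
          ENNReal.tsum_le_tsum hterm
      _ ≤ ENNReal.ofReal T * ENNReal.ofReal κ := by
          rw [ENNReal.tsum_mul_left]
          exact mul_le_mul_right hsumlevel _
      _ = _ := (ENNReal.ofReal_mul (by positivity)).symm
  have hlim : Filter.Tendsto (fun κ : ℝ => ENNReal.ofReal (T * κ)) (nhdsWithin 0 (Ioi 0))
      (nhds 0) := by
    have h : Continuous fun κ : ℝ => ENNReal.ofReal (T * κ) :=
      ENNReal.continuous_ofReal.comp (continuous_const_mul T)
    have h1 := h.tendsto 0
    rw [mul_zero, ENNReal.ofReal_zero] at h1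
    exact h1.mono_left nhdsWithin_le_nhds
  refine le_antisymm (ge_of_tendsto hlim ?_) bot_le
  filter_upwards [Ioo_mem_nhdsGT (show (0:ℝ) < τ ^ p by positivity)] with κ hκ
  exact hmain κ hκ.1 hκ.2

/-- The Kakeya maximal function conjecture implies that the conformal dimension of Kakeya
sets in `ℝⁿ` is `n`. -/
theorem stmt15 {n : ℕ} (hn : 2 ≤ n)
    (hyp : ∀ ε > (0:ℝ), ∃ C > (0:ℝ), ∀ δ ∈ Set.Ioo (0:ℝ) 1,
      ∀ f : EuclideanSpace ℝ (Fin n) → ℝ, Measurable f →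
        (∫⁻ e in Metric.sphere (0 : EuclideanSpace ℝ (Fin n)) 1,
            (kakeyaMax δ f e) ^ (n : ℝ) ∂(μH[((n : ℝ) - 1)])) ^ (1 / (n : ℝ)) ≤
          ENNReal.ofReal (C * δ ^ (-ε)) *
            (∫⁻ y, ENNReal.ofReal |f y| ^ (n : ℝ)) ^ (1 / (n : ℝ)))
    {X : Type*} [MetricSpace X]
    (K S : Set (EuclideanSpace ℝ (Fin n)))
    (hS : S ⊆ Metric.sphere (0 : EuclideanSpace ℝ (Fin n)) 1)
    (hSpos : 0 < μH[((n : ℝ) - 1)] S)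
    (hKak : ∀ e ∈ S, ∃ x, seg e x ⊆ K)
    (g : EuclideanSpace ℝ (Fin n) → X) (η : ℝ → ℝ)
    (hη : IsQSGauge η) (hqs : IsQSOn η g K) (hinj : Set.InjOn g K) :
    (n : ℝ≥0∞) ≤ dimH (g '' K) := by
  by_contra hlt
  obtain ⟨p, hp1, hp2⟩ := ENNReal.lt_iff_exists_nnreal_btwn.1 (not_le.1 hlt)
  borelize X
  have hp : (0:ℝ) < p := by
    have : (0 : ℝ≥0∞) < p := bot_le.trans_lt hp1
    exact_mod_cast this
  have hpn : (p : ℝ) < n := by exact_mod_cast hp2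
  have hzero : μH[(p : ℝ)] (g '' K) = 0 := hausdorffMeasure_of_dimH_lt hp1
  set A : ℕ → Set (EuclideanSpace ℝ (Fin n)) := fun m => {e ∈ S | ∃ x, seg e x ⊆ K ∧
    1 / ((m : ℝ) + 1) ≤ dist (g x) (g (x + e)) ∧ dist (g x) (g (x + e)) ≤ (m : ℝ) + 1} with hA
  have hcover : S ⊆ ⋃ m, A m := by
    intro e he
    obtain ⟨x, hx⟩ := hKak e he
    have he1 : ‖e‖ = 1 := mem_sphere_zero_iff_norm.1 (hS he)
    have hpos : 0 < dist (g x) (g (x + e)) := by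
      refine dist_pos.2 fun h => ?_
      have h0 := hinj (hx ⟨0, ⟨le_rfl, zero_le_one⟩, by simp⟩)
        (hx ⟨1, ⟨zero_le_one, le_rfl⟩, by simp⟩) h
      rw [left_eq_add] at h0
      simp [h0] at he1
    obtain ⟨m₁, h1⟩ := exists_nat_one_div_lt hpos
    obtain ⟨m₂, h2⟩ := exists_nat_ge (dist (g x) (g (x + e)))
    refine mem_iUnion.2 ⟨max m₁ m₂, he, x, hx, ?_, ?_⟩
    · refine le_trans ?_ h1.le
      gcongr
      exact le_max_left _ _
    · have : (m₂ : ℝ) ≤ (max m₁ m₂ : ℕ) := by exact_mod_cast le_max_right _ _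
      linarith
  refine hSpos.ne' (measure_mono_null hcover (measure_iUnion_null fun m => ?_))
  exact hausdorffMeasure_directions_eq_zero (by omega) hyp (fun e he => hS he.1) hη hqs
    (by positivity) (by positivity) (fun e he => he.2) hp hpn hzero
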